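/- Let a = (a_1,a_2) be a degree sequence with 0 < a_1 ≤ a_2, and let I ⊆ A = K[x_1,x_2] be a homogeneous ideal containing the ideal (x_1^{a_1}, x_2^{a_2}). Then there exists an (a_1,a_2)-lpp ideal with the same Hilbert function as I. -/

import Mathlib

open MvPolynomial

section Defs

variable {K : Type*} [Field K]

/-- Total degree of an exponent vector. -/
def expDeg {n : ℕ} (m : Fin n →₀ ℕ) : ℕ := ∑ i, m i

/-- `lexLe m m'` means `m ≤ m'` in the lexicographic order with `x_1 > x_2 > … > x_n`. -/
def lexLe {n : ℕ} (m m' : Fin n →₀ ℕ) : Prop :=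
  m = m' ∨ ∃ i : Fin n, (∀ j : Fin n, j < i → m j = m' j) ∧ m i < m' i

/-- A lex-segment in degree `d`: an upward (w.r.t. lex) closed set of degree-`d`
exponent vectors. -/
def IsLexSegment (n d : ℕ) (S : Set (Fin n →₀ ℕ)) : Prop :=
  (∀ m ∈ S, expDeg m = d) ∧
    ∀ m ∈ S, ∀ m' : Fin n →₀ ℕ, expDeg m' = d → lexLe m m' → m' ∈ S

/-- The pure-powers ideal `(x_1^{a_1}, …, x_r^{a_r})`. -/
noncomputable def purePowers (K : Type*) [Field K] {n r : ℕ} (hrn : r ≤ n)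
    (a : Fin r → ℕ) : Ideal (MvPolynomial (Fin n) K) :=
  Ideal.span (Set.range fun i : Fin r => X (Fin.castLE hrn i) ^ a i)

/-- A homogeneous ideal. -/
def IsHomog {n : ℕ} (I : Ideal (MvPolynomial (Fin n) K)) : Prop :=
  ∀ f ∈ I, ∀ d : ℕ, homogeneousComponent d f ∈ I

/-- The degree-`d` component of an ideal, as a `K`-subspace. -/
noncomputable def component {n : ℕ} (I : Ideal (MvPolynomial (Fin n) K)) (d : ℕ) :
    Submodule K (MvPolynomial (Fin n) K) :=
  Submodule.restrictScalars K I ⊓ homogeneousSubmodule (Fin n) K d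

/-- Hilbert function of an ideal: `dim_K I_d`. -/
noncomputable def hilb {n : ℕ} (I : Ideal (MvPolynomial (Fin n) K)) (d : ℕ) : ℕ :=
  Module.finrank K ↥(component I d)

/-- An `a`-lpp (lex-plus-powers) ideal: a homogeneous (monomial) ideal each of whose graded
components is the span of a lex-segment plus the corresponding component of the
pure-powers ideal. -/
def IsLPP {n r : ℕ} (hrn : r ≤ n) (a : Fin r → ℕ)
    (J : Ideal (MvPolynomial (Fin n) K)) : Prop :=
  IsHomog J ∧
    ∀ d : ℕ, ∃ S : Set (Fin n →₀ ℕ), IsLexSegment n d S ∧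
      component J d =
        Submodule.span K ((fun m => (monomial m (1 : K) : MvPolynomial (Fin n) K)) '' S)
          ⊔ component (purePowers K hrn a) d

/-- `I` satisfies `EGH_a(d)`. -/
def EGHd {n r : ℕ} (hrn : r ≤ n) (a : Fin r → ℕ)
    (I : Ideal (MvPolynomial (Fin n) K)) (d : ℕ) : Prop :=
  ∃ J : Ideal (MvPolynomial (Fin n) K), IsLPP hrn a J ∧
    hilb J d = hilb I d ∧ hilb J (d + 1) ≤ hilb I (d + 1)

/-- `I` satisfies `EGH_a`. -/
def EGH {n r : ℕ} (hrn : r ≤ n) (a : Fin r → ℕ)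
    (I : Ideal (MvPolynomial (Fin n) K)) : Prop :=
  ∀ d : ℕ, EGHd hrn a I d

/-- A monomial ideal. -/
def IsMonomialIdeal {n : ℕ} (I : Ideal (MvPolynomial (Fin n) K)) : Prop :=
  ∃ M : Set (Fin n →₀ ℕ),
    I = Ideal.span ((fun m => (monomial m (1 : K) : MvPolynomial (Fin n) K)) '' M)

/-- A strongly stable (monomial) ideal. -/
def IsStronglyStable {n : ℕ} (S : Ideal (MvPolynomial (Fin n) K)) : Prop :=
  IsMonomialIdeal S ∧
    ∀ (m : Fin n →₀ ℕ) (i j : Fin n), j ≤ i →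
      (monomial (m + Finsupp.single i 1) (1 : K) : MvPolynomial (Fin n) K) ∈ S →
      (monomial (m + Finsupp.single j 1) (1 : K) : MvPolynomial (Fin n) K) ∈ S

/-- An `a`-spp (strongly-stable-plus-powers) ideal. -/
def IsSPP {n r : ℕ} (hrn : r ≤ n) (a : Fin r → ℕ)
    (J : Ideal (MvPolynomial (Fin n) K)) : Prop :=
  ∃ S : Ideal (MvPolynomial (Fin n) K), IsStronglyStable S ∧ J = S ⊔ purePowers K hrn a

/-- A regular sequence: each `f i` is a non-zerodivisor modulo `(f j : j < i)`. -/
def IsRegSeq {n r : ℕ} (f : Fin r → MvPolynomial (Fin n) K) : Prop :=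
  ∀ i : Fin r, ∀ g : MvPolynomial (Fin n) K,
    g * f i ∈ Ideal.span { p | ∃ j : Fin r, j < i ∧ p = f j } →
    g ∈ Ideal.span { p | ∃ j : Fin r, j < i ∧ p = f j }

/-- `I` contains a homogeneous regular sequence of degree `a`. -/
def ContainsRegSeq {n r : ℕ} (a : Fin r → ℕ)
    (I : Ideal (MvPolynomial (Fin n) K)) : Prop :=
  ∃ f : Fin r → MvPolynomial (Fin n) K,
    (∀ i, f i ∈ I) ∧ IsRegSeq f ∧ ∀ i, (f i).IsHomogeneous (a i)

/-- `dim_K (N/P)` for ideals `P ≤ N` (the `K`-dimension of `N/(N ∩ P)`). -/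
noncomputable def quotDim (K : Type*) [Field K] {n : ℕ}
    (N P : Ideal (MvPolynomial (Fin n) K)) : ℕ :=
  Module.finrank K
    (↥(Submodule.restrictScalars K N) ⧸
      Submodule.comap (Submodule.restrictScalars K N).subtype (Submodule.restrictScalars K P))

/-- `dim_K (I/F)_d`. -/
noncomputable def relHilb {n : ℕ} (I F : Ideal (MvPolynomial (Fin n) K)) (d : ℕ) : ℕ :=
  Module.finrank K
    (↥(component I d) ⧸ Submodule.comap (component I d).subtype (Submodule.restrictScalars K F))

/-- `dim_K (A/I)_d`. -/
noncomputable def hilbQ {n : ℕ} (I : Ideal (MvPolynomial (Fin n) K)) (d : ℕ) : ℕ :=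
  Module.finrank K
    (↥(homogeneousSubmodule (Fin n) K d) ⧸
      Submodule.comap (homogeneousSubmodule (Fin n) K d).subtype (Submodule.restrictScalars K I))

end Defs

theorem degree_fin_two (m : Fin 2 →₀ ℕ) : m.degree = m 0 + m 1 := by
  rw [Finsupp.degree_eq_sum, Fin.sum_univ_two]

/-- The exponent vector of `x_1 ^ i * x_2 ^ j`. -/
noncomputable def bivExp (i j : ℕ) : Fin 2 →₀ ℕ := Finsupp.single 0 i + Finsupp.single 1 j

@[simp] theorem bivExp_zero (i j : ℕ) : bivExp i j 0 = i := by simp [bivExp]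

@[simp] theorem bivExp_one (i j : ℕ) : bivExp i j 1 = j := by simp [bivExp]

theorem bivExp_eta (m : Fin 2 →₀ ℕ) : bivExp (m 0) (m 1) = m := by
  ext k; fin_cases k <;> simp

theorem le_iff_fin_two (m m' : Fin 2 →₀ ℕ) : m ≤ m' ↔ m 0 ≤ m' 0 ∧ m 1 ≤ m' 1 := by
  rw [Finsupp.le_def, Fin.forall_fin_two]

theorem ncard_degree_eq (d : ℕ) (P : ℕ → Prop) [DecidablePred P] :
    {m : Fin 2 →₀ ℕ | m 0 + m 1 = d ∧ P (m 0)}.ncard = ((Finset.range (d + 1)).filter P).card := by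
  rw [← Set.ncard_coe_finset]
  have hinj : Set.InjOn (fun i => bivExp i (d - i)) ((Finset.range (d + 1)).filter P : Set ℕ) := by
    intro i _ j _ h
    simpa using DFunLike.congr_fun h 0
  rw [← hinj.ncard_image]
  congr 1
  ext m
  constructor
  · rintro ⟨hm, hP⟩
    refine ⟨m 0, by simpa using ⟨by omega, hP⟩, ?_⟩
    have : d - m 0 = m 1 := by omega
    simp only [this, bivExp_eta]
  · rintro ⟨i, hi, rfl⟩
    simp only [Finset.coe_filter, Finset.mem_range, Set.mem_ofPred_eq] at hi
    simpa using ⟨by omega, hi.2⟩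

section Components

variable {K : Type*} [Field K]

theorem finrank_restrictSupport {σ : Type*} (s : Set (σ →₀ ℕ)) :
    Module.finrank K (restrictSupport K s) = s.ncard := by
  rw [Module.finrank_eq_nat_card_basis (basisRestrictSupport K s), Nat.card_coe_set_eq]

theorem homogeneousSubmodule_eq_restrictSupport (d : ℕ) :
    homogeneousSubmodule (Fin 2) K d = restrictSupport K {m | m 0 + m 1 = d} := by
  simp_rw [← degree_fin_two]
  exact homogeneousSubmodule_eq_finsupp_supported _ _ _

instance finiteDimensional_homogeneousSubmodule (n d : ℕ) :
    FiniteDimensional K (homogeneousSubmodule (Fin n) K d) :=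
  Module.Finite.iff_fg.mpr (homogeneousSubmodule_fg _ _ _)

instance finiteDimensional_component {n : ℕ} (I : Ideal (MvPolynomial (Fin n) K)) (d : ℕ) :
    FiniteDimensional K (component I d) :=
  Submodule.finiteDimensional_of_le (inf_le_right : _ ≤ homogeneousSubmodule (Fin n) K d)

theorem mem_component {n : ℕ} {I : Ideal (MvPolynomial (Fin n) K)} {d : ℕ}
    {f : MvPolynomial (Fin n) K} : f ∈ component I d ↔ f ∈ I ∧ f.IsHomogeneous d := Iff.rfl

theorem finrank_homogeneousSubmodule_fin_two (d : ℕ) :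
    Module.finrank K (homogeneousSubmodule (Fin 2) K d) = d + 1 := by
  rw [homogeneousSubmodule_eq_restrictSupport, finrank_restrictSupport]
  simpa using ncard_degree_eq d (fun _ => True)

theorem hilb_le (I : Ideal (MvPolynomial (Fin 2) K)) (d : ℕ) : hilb I d ≤ d + 1 := by
  rw [← finrank_homogeneousSubmodule_fin_two (K := K) d]
  exact Submodule.finrank_mono inf_le_right

theorem component_span_monomial (G : Set (Fin 2 →₀ ℕ)) (d : ℕ) :
    component (Ideal.span ((fun m => (monomial m (1 : K))) '' G)) d =
      restrictSupport K {m | m 0 + m 1 = d ∧ ∃ s ∈ G, s ≤ m} := by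
  ext f
  rw [component, homogeneousSubmodule_eq_restrictSupport, Submodule.mem_inf,
    Submodule.restrictScalars_mem, mem_ideal_span_monomial_image, mem_restrictSupport_iff,
    mem_restrictSupport_iff]
  simp only [Set.subset_def, Finset.mem_coe, Set.mem_ofPred_eq]
  exact ⟨fun h m hm => ⟨h.2 m hm, h.1 m hm⟩, fun h => ⟨fun m hm => (h m hm).2, fun m hm => (h m hm).1⟩⟩

theorem isHomog_span_monomial {n : ℕ} (G : Set (Fin n →₀ ℕ)) :
    IsHomog (Ideal.span ((fun m => (monomial m (1 : K))) '' G)) := by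
  intro f hf d
  rw [mem_ideal_span_monomial_image] at hf ⊢
  intro m hm
  refine hf m ?_
  rw [mem_support_iff, coeff_homogeneousComponent] at hm
  rw [mem_support_iff]
  exact fun h => hm (by simp [h])

theorem purePowers_eq_span_monomial (a : Fin 2 → ℕ) :
    purePowers K (le_refl 2) a =
      Ideal.span ((fun m => (monomial m (1 : K))) '' {bivExp (a 0) 0, bivExp 0 (a 1)}) := by
  rw [purePowers, Set.image_pair]
  congr 1
  ext f
  simp [Fin.exists_fin_two, bivExp, X_pow_eq_monomial, eq_comm]

theorem component_purePowers (a : Fin 2 → ℕ) (d : ℕ) :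
    component (purePowers K (le_refl 2) a) d =
      restrictSupport K {m | m 0 + m 1 = d ∧ (a 0 ≤ m 0 ∨ a 1 ≤ m 1)} := by
  rw [purePowers_eq_span_monomial, component_span_monomial]
  simp [le_iff_fin_two]

theorem X_mul_mem_component {n : ℕ} {I : Ideal (MvPolynomial (Fin n) K)} {d : ℕ}
    {f : MvPolynomial (Fin n) K} (hf : f ∈ component I d) (k : Fin n) :
    X k * f ∈ component I (d + 1) := by
  rw [mem_component] at hf ⊢
  refine ⟨I.mul_mem_left _ hf.1, ?_⟩
  rw [add_comm]
  exact (isHomogeneous_X K k).mul hf.2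

theorem X_mulLeft_injective {n : ℕ} (k : Fin n) :
    Function.Injective (LinearMap.mulLeft K (X k : MvPolynomial (Fin n) K)) :=
  mul_right_injective₀ (X_ne_zero k)

theorem map_X_component_le {n : ℕ} (I : Ideal (MvPolynomial (Fin n) K)) (d : ℕ) (k : Fin n) :
    (component I d).map (LinearMap.mulLeft K (X k)) ≤ component I (d + 1) := by
  rintro _ ⟨f, hf, rfl⟩
  exact X_mul_mem_component hf k

theorem finrank_map_X_component {n : ℕ} (I : Ideal (MvPolynomial (Fin n) K)) (d : ℕ)
    (k : Fin n) :
    Module.finrank K ((component I d).map (LinearMap.mulLeft K (X k))) = hilb I d :=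
  (Submodule.equivMapOfInjective _ (X_mulLeft_injective k) (component I d)).finrank_eq.symm

/-- The Hilbert function of an ideal strictly increases once it is nonzero. -/
theorem hilb_lt_hilb_succ (I : Ideal (MvPolynomial (Fin 2) K)) (d : ℕ) (h : 0 < hilb I d) :
    hilb I d < hilb I (d + 1) := by
  by_contra! hle
  have heq := Submodule.eq_of_le_of_finrank_le (map_X_component_le I d 1)
    (hle.trans (finrank_map_X_component I d 1).ge)
  have key : ∀ j i : ℕ, ∀ f ∈ component I d, coeff (bivExp i j) f = 0 := by
    intro j
    induction j with
    | zero =>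
      intro i f hf
      have hx := X_mul_mem_component hf 0
      rw [← heq] at hx
      obtain ⟨g, -, hfg⟩ := hx
      have hc := congrArg (coeff (bivExp i 0 + Finsupp.single 0 1)) hfg
      rw [add_comm (bivExp i 0), coeff_X_mul, LinearMap.mulLeft_apply, coeff_X_mul'] at hc
      simpa [bivExp] using hc.symm
    | succ j ih =>
      intro i f hf
      have hx := X_mul_mem_component hf 0
      rw [← heq] at hx
      obtain ⟨g, hg, hfg⟩ := hx
      have hexp : Finsupp.single 0 1 + bivExp i (j + 1) =
          Finsupp.single 1 1 + bivExp (i + 1) j := by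
        ext k; fin_cases k <;> simp [add_comm]
      have hc := congrArg (coeff (Finsupp.single 0 1 + bivExp i (j + 1))) hfg
      rw [coeff_X_mul, LinearMap.mulLeft_apply, hexp, coeff_X_mul, ih _ g hg] at hc
      exact hc.symm
  have hbot : component I d = ⊥ := by
    rw [Submodule.eq_bot_iff]
    intro f hf
    ext m
    rw [← bivExp_eta m, key _ _ f hf, coeff_zero]
  rw [hilb, hbot, finrank_bot] at h
  exact h.false

theorem X_zero_mul_monomial (i j : ℕ) :
    (X 0 * monomial (bivExp i j) 1 : MvPolynomial (Fin 2) K) = monomial (bivExp (i + 1) j) 1 := by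
  rw [X, monomial_mul, one_mul]
  congr 2
  ext k; fin_cases k <;> simp [add_comm]

theorem X_one_mul_monomial (i j : ℕ) :
    (X 1 * monomial (bivExp i j) 1 : MvPolynomial (Fin 2) K) = monomial (bivExp i (j + 1)) 1 := by
  rw [X, monomial_mul, one_mul]
  congr 2
  ext k; fin_cases k <;> simp [add_comm]

/-- If the degree `d + 1` part of `I` contains both pure powers and is small compared to the
degree `d` part, then it is everything. -/
theorem hilb_succ_eq (I : Ideal (MvPolynomial (Fin 2) K)) (d : ℕ)
    (hx : monomial (bivExp (d + 1) 0) 1 ∈ I) (hy : monomial (bivExp 0 (d + 1)) 1 ∈ I)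
    (h : hilb I (d + 1) ≤ hilb I d + 1) : hilb I (d + 1) = d + 2 := by
  have hmem : ∀ i j, i + j = d + 1 → monomial (bivExp i j) (1 : K) ∈ I →
      monomial (bivExp i j) (1 : K) ∈ component I (d + 1) := fun i j hij hI =>
    mem_component.mpr ⟨hI, isHomogeneous_monomial _ (by simpa [degree_fin_two] using hij)⟩
  set W : Submodule K (MvPolynomial (Fin 2) K) :=
    component I (d + 1) ⊓ LinearMap.ker (lcoeff K (bivExp (d + 1) 0)) with hW
  have hWlt : W < component I (d + 1) := by
    refine lt_of_le_of_ne inf_le_left fun heq => ?_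
    have := heq ▸ hmem _ _ (add_zero _) hx
    simpa [lcoeff] using this.2
  have hle : (component I d).map (LinearMap.mulLeft K (X 1)) ≤ W := by
    refine le_inf (map_X_component_le I d 1) ?_
    rintro _ ⟨f, -, rfl⟩
    simp [lcoeff, coeff_X_mul', bivExp]
  have hWfin : FiniteDimensional K W := Submodule.finiteDimensional_of_le hWlt.le
  have hWeq := Submodule.eq_of_le_of_finrank_le hle (by
    rw [finrank_map_X_component]
    have := Submodule.finrank_lt_finrank_of_lt hWlt
    change _ < hilb I (d + 1) at this
    omega)
  have hdiv : ∀ i j, i + j = d → monomial (bivExp i (j + 1)) (1 : K) ∈ I →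
      monomial (bivExp i j) (1 : K) ∈ I := by
    intro i j hij hI
    have hw : monomial (bivExp i (j + 1)) (1 : K) ∈ W := by
      refine ⟨hmem _ _ (by omega) hI, ?_⟩
      have : bivExp i (j + 1) ≠ bivExp (d + 1) 0 := fun h => by
        simpa using DFunLike.congr_fun h 1
      simp [lcoeff, coeff_monomial, this]
    rw [← hWeq] at hw
    obtain ⟨g, hg, hgw⟩ := hw
    rw [← X_one_mul_monomial] at hgw
    rw [← X_mulLeft_injective 1 hgw]
    exact hg.1
  have hall : ∀ i j, i + j = d + 1 → monomial (bivExp i j) (1 : K) ∈ I := by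
    intro i
    induction i with
    | zero => rintro j hj; rw [zero_add] at hj; rwa [hj]
    | succ i ih =>
      intro j hj
      rw [← X_zero_mul_monomial]
      exact I.mul_mem_left _ (hdiv i j (by omega) (ih (j + 1) (by omega)))
  have htop : component I (d + 1) = homogeneousSubmodule (Fin 2) K (d + 1) := by
    refine le_antisymm inf_le_right ?_
    rw [homogeneousSubmodule_eq_restrictSupport, restrictSupport_eq_span, Submodule.span_le]
    rintro _ ⟨m, hm, rfl⟩
    have := hmem (m 0) (m 1) hm (hall _ _ hm)
    rwa [bivExp_eta] at this
  rw [hilb, htop, finrank_homogeneousSubmodule_fin_two]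

/-- The exponents whose first coordinate is outside the lowest `q d` non-pure positions in each
degree `d`. -/
def lppExponents (A B : ℕ) (q : ℕ → ℕ) : Set (Fin 2 →₀ ℕ) :=
  {m | A ≤ m 0 ∨ B ≤ m 1 ∨ m 0 + m 1 + 1 - B + q (m 0 + m 1) ≤ m 0}

theorem isUpperSet_lppExponents {A B : ℕ} {q : ℕ → ℕ} (hAB : A ≤ B)
    (hlow : ∀ d, q d ≤ d → q (d + 1) ≤ q d)
    (hhigh : ∀ d, B ≤ d + 1 → q (d + 1) = 0 ∨ q (d + 1) < q d) :
    IsUpperSet (lppExponents A B q) := by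
  have hstep : ∀ i j, (A ≤ i ∨ B ≤ j ∨ i + j + 1 - B + q (i + j) ≤ i) →
      (A ≤ i + 1 ∨ B ≤ j ∨ i + 1 + j + 1 - B + q (i + 1 + j) ≤ i + 1) ∧
      (A ≤ i ∨ B ≤ j + 1 ∨ i + (j + 1) + 1 - B + q (i + (j + 1)) ≤ i) := by
    intro i j h
    have h1 := hlow (i + j)
    have h2 := hhigh (i + j)
    rw [show i + 1 + j = i + j + 1 by omega, show i + (j + 1) = i + j + 1 by omega]
    omega
  have hleft : ∀ k i j, (A ≤ i ∨ B ≤ j ∨ i + j + 1 - B + q (i + j) ≤ i) →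
      (A ≤ i + k ∨ B ≤ j ∨ i + k + j + 1 - B + q (i + k + j) ≤ i + k) := by
    intro k i j h
    induction k with
    | zero => exact h
    | succ k ih => exact (hstep _ _ ih).1
  have hright : ∀ k i j, (A ≤ i ∨ B ≤ j ∨ i + j + 1 - B + q (i + j) ≤ i) →
      (A ≤ i ∨ B ≤ j + k ∨ i + (j + k) + 1 - B + q (i + (j + k)) ≤ i) := by
    intro k i j h
    induction k with
    | zero => exact h
    | succ k ih => exact (hstep _ _ ih).2
  intro m m' hmm hm
  obtain ⟨h0, h1⟩ := (le_iff_fin_two m m').mp hmm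
  obtain ⟨k, hk⟩ := Nat.exists_eq_add_of_le h0
  obtain ⟨l, hl⟩ := Nat.exists_eq_add_of_le h1
  simp only [lppExponents, Set.mem_ofPred_eq, hk, hl]
  exact hright l _ _ (hleft k _ _ hm)

theorem component_span_lppExponents {A B : ℕ} {q : ℕ → ℕ}
    (hup : IsUpperSet (lppExponents A B q)) (d : ℕ) :
    component (Ideal.span ((fun m => (monomial m (1 : K))) '' lppExponents A B q)) d =
      restrictSupport K {m | m 0 + m 1 = d ∧ (A ≤ m 0 ∨ B ≤ m 1 ∨ d + 1 - B + q d ≤ m 0)} := by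
  rw [component_span_monomial]
  congr 1
  ext m
  refine and_congr_right fun hm => ?_
  subst hm
  exact ⟨fun ⟨s, hs, hsm⟩ => hup hsm hs, fun h => ⟨m, h, le_rfl⟩⟩

theorem restrictSupport_union {σ : Type*} (s t : Set (σ →₀ ℕ)) :
    restrictSupport K (s ∪ t) = restrictSupport K s ⊔ restrictSupport K t := by
  simp_rw [restrictSupport_eq_span, Set.image_union, Submodule.span_union]

theorem isLPP_span_lppExponents (a : Fin 2 → ℕ) {q : ℕ → ℕ}
    (hup : IsUpperSet (lppExponents (a 0) (a 1) q)) :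
    IsLPP (le_refl 2) a
      (Ideal.span ((fun m => (monomial m (1 : K))) '' lppExponents (a 0) (a 1) q)) := by
  refine ⟨isHomog_span_monomial _, fun d => ⟨{m | m 0 + m 1 = d ∧ d + 1 - a 1 + q d ≤ m 0},
    ⟨fun m hm => ?_, fun m hm m' hd hle => ⟨?_, ?_⟩⟩, ?_⟩⟩
  · rw [expDeg, Fin.sum_univ_two]
    exact hm.1
  · rw [← hd, expDeg, Fin.sum_univ_two]
  · refine hm.2.trans ?_
    obtain rfl | ⟨i, hi, hlt⟩ := hle
    · exact le_rfl
    · fin_cases i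
      · exact hlt.le
      · exact (hi 0 (by simp)).le
  · rw [component_span_lppExponents hup, component_purePowers, ← restrictSupport_eq_span,
      ← restrictSupport_union]
    congr 1
    ext m
    simp only [Set.mem_ofPred_eq, Set.mem_union]
    tauto

theorem hilb_eq_card {P : ℕ → Prop} [DecidablePred P] {I : Ideal (MvPolynomial (Fin 2) K)}
    {d : ℕ} (h : component I d = restrictSupport K {m | m 0 + m 1 = d ∧ P (m 0)}) :
    hilb I d = ((Finset.range (d + 1)).filter P).card := by
  rw [hilb, h, finrank_restrictSupport, ncard_degree_eq]

theorem hilb_purePowers (a : Fin 2 → ℕ) (d : ℕ) :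
    hilb (purePowers K (le_refl 2) a) d + (min (a 0) (d + 1) - (d + 1 - a 1)) = d + 1 := by
  rw [hilb_eq_card (P := fun i => a 0 ≤ i ∨ a 1 ≤ d - i) ?_]
  · have h := Finset.card_filter_add_card_filter_not (s := Finset.range (d + 1))
      (fun i => a 0 ≤ i ∨ a 1 ≤ d - i)
    rw [Finset.card_range] at h
    convert h using 2
    rw [← Nat.card_Ico]
    congr 1
    ext i
    simp only [Finset.mem_Ico, Finset.mem_filter, Finset.mem_range]
    omega
  · rw [component_purePowers]
    congr 1
    ext m
    simp only [Set.mem_ofPred_eq]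
    omega

theorem hilb_span_lppExponents {A B : ℕ} {q : ℕ → ℕ} (hup : IsUpperSet (lppExponents A B q))
    {d : ℕ} (hq : q d ≤ min A (d + 1) - (d + 1 - B)) :
    hilb (Ideal.span ((fun m => (monomial m (1 : K))) '' lppExponents A B q)) d + q d =
      d + 1 := by
  rw [hilb_eq_card (P := fun i => A ≤ i ∨ B ≤ d - i ∨ d + 1 - B + q d ≤ i) ?_]
  · have h := Finset.card_filter_add_card_filter_not (s := Finset.range (d + 1))
      (fun i => A ≤ i ∨ B ≤ d - i ∨ d + 1 - B + q d ≤ i)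
    rw [Finset.card_range] at h
    convert h using 2
    refine (Nat.add_sub_cancel_left (n := d + 1 - B) (m := q d)).symm.trans ?_
    rw [← Nat.card_Ico]
    congr 1
    ext i
    simp only [Finset.mem_Ico, Finset.mem_filter, Finset.mem_range]
    omega
  · rw [component_span_lppExponents hup]
    congr 1
    ext m
    simp only [Set.mem_ofPred_eq]
    omega

theorem monomial_mem_purePowers (a : Fin 2 → ℕ) {i j : ℕ} (h : a 0 ≤ i ∨ a 1 ≤ j) :
    monomial (bivExp i j) (1 : K) ∈ purePowers K (le_refl 2) a := by
  refine (mem_component (d := i + j)).mp ?_ |>.1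
  rw [component_purePowers, monomial_mem_restrictSupport]
  simpa using h

end Components

/-- For a homogeneous ideal `I ⊆ K[x_1,x_2]` containing `(x_1^{a_1}, x_2^{a_2})` with
`0 < a_1 ≤ a_2`, there exists an `(a_1,a_2)`-lpp ideal with the same Hilbert function. -/
theorem lpp_two_variables {K : Type*} [Field K] (a : Fin 2 → ℕ)
    (hpos : 0 < a 0) (hmono : a 0 ≤ a 1)
    (I : Ideal (MvPolynomial (Fin 2) K)) (hI : IsHomog I)
    (hPP : purePowers K (le_refl 2) a ≤ I) :
    ∃ J : Ideal (MvPolynomial (Fin 2) K), IsLPP (le_refl 2) a J ∧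
      ∀ d : ℕ, hilb J d = hilb I d := by
  have hadd : ∀ d, hilb I d + (d + 1 - hilb I d) = d + 1 := fun d =>
    Nat.add_sub_cancel' (hilb_le I d)
  have hup : IsUpperSet (lppExponents (a 0) (a 1) fun d => d + 1 - hilb I d) := by
    refine isUpperSet_lppExponents hmono (fun d hd => ?_) fun d hd => ?_
    · have := hilb_lt_hilb_succ I d (by omega)
      omega
    · by_contra! hcon
      have h1 := hadd d
      have h2 := hadd (d + 1)
      have := hilb_succ_eq I d (hPP (monomial_mem_purePowers a (Or.inl (by omega))))
        (hPP (monomial_mem_purePowers a (Or.inr hd))) (by omega)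
      omega
  refine ⟨_, isLPP_span_lppExponents a hup, fun d => ?_⟩
  have hle : hilb (purePowers K (le_refl 2) a) d ≤ hilb I d :=
    Submodule.finrank_mono (inf_le_inf_right _ hPP)
  have hpp := hilb_purePowers (K := K) a d
  have := hilb_span_lppExponents (K := K) hup (d := d) (by omega)
  have := hadd d
  omega
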